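/- arXiv:2209.02975 — 2 statements merged into one kernel-verified Lean document; each statement's English description precedes it below -/
import Mathlib

section
/- For positive integers M and N with max{M, N} ≥ 2, the inverse of Γᵀ Γ equals (1/D)·[[MK − M²(M+1)²/4, MN(M+1)(N+1)/4, −MN(N+1)/2], [MN(M+1)(N+1)/4, NK − N²(N+1)²/4, −NM(M+1)/2], [−MN(N+1)/2, −NM(M+1)/2, MN]], where K = N(N+1)(2N+1)/6 + M(M+1)(2M+1)/6 and D = (MN/12)(N(N²−1) + M(M²−1)). -/
open Matrix

/-- The design matrix `Γ_{M,N}` of Step 1 of the proposed estimation method: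
its `n`-th row is `(1, 0, n)` for `n = 1,…,N` and its `(N+m)`-th row is `(0, 1, m)`
for `m = 1,…,M`. -/
noncomputable def Gamma (M N : ℕ) : Matrix (Fin (N + M)) (Fin 3) ℝ :=
  fun i j =>
    if (i : ℕ) < N then
      if j = 0 then 1 else if j = 1 then 0 else (((i : ℕ) + 1 : ℕ) : ℝ)
    else
      if j = 0 then 0 else if j = 1 then 1 else (((i : ℕ) - N + 1 : ℕ) : ℝ)


lemma sum_id_aux (n : ℕ) : ∑ i : Fin n, ((i : ℕ) + 1 : ℝ) = (n : ℝ) * (n + 1) / 2 := by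
  induction n with
  | zero => simp
  | succ k ih =>
    rw [Fin.sum_univ_castSucc]
    simp only [Fin.val_castSucc, Fin.val_last, ih]
    push_cast
    ring

lemma sum_sq_aux (n : ℕ) :
    ∑ i : Fin n, ((i : ℕ) + 1 : ℝ) * ((i : ℕ) + 1 : ℝ)
      = (n : ℝ) * (n + 1) * (2 * n + 1) / 6 := by
  induction n with
  | zero => simp
  | succ k ih =>
    rw [Fin.sum_univ_castSucc]
    simp only [Fin.val_castSucc, Fin.val_last, ih]
    push_cast
    ring

lemma gram_aux (M N : ℕ) : (Gamma M N)ᵀ * Gamma M N =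
    !![(N : ℝ), 0, (N : ℝ) * (N + 1) / 2;
       0, (M : ℝ), (M : ℝ) * (M + 1) / 2;
       (N : ℝ) * (N + 1) / 2, (M : ℝ) * (M + 1) / 2,
       (N : ℝ) * (N + 1) * (2 * N + 1) / 6 + (M : ℝ) * (M + 1) * (2 * M + 1) / 6] := by
  rw [← sum_sq_aux, ← sum_sq_aux, ← sum_id_aux, ← sum_id_aux]
  ext i j
  rw [Matrix.mul_apply, Fin.sum_univ_add]
  fin_cases i <;> fin_cases j <;> simp [Gamma]

lemma cube_aux (n : ℕ) (h : 0 < n) : 0 ≤ (n : ℝ) * ((n : ℝ) ^ 2 - 1) := by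
  have : (1 : ℝ) ≤ n := by exact_mod_cast h
  exact mul_nonneg (by linarith) (by nlinarith)

lemma cube_aux2 (n : ℕ) (h : 2 ≤ n) : 0 < (n : ℝ) * ((n : ℝ) ^ 2 - 1) := by
  have : (2 : ℝ) ≤ n := by exact_mod_cast h
  exact mul_pos (by linarith) (by nlinarith)

/-- explicit formula for `(Γᵀ Γ)⁻¹` when `max{M, N} ≥ 2`, with
`K = N(N+1)(2N+1)/6 + M(M+1)(2M+1)/6` and `D = (MN/12)(N(N²−1) + M(M²−1))`. -/
theorem gamma_gram_inverse (M N : ℕ) (hM : 0 < M) (hN : 0 < N) (h2 : 2 ≤ max M N)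
    (K D : ℝ)
    (hK : K = (N : ℝ) * (N + 1) * (2 * N + 1) / 6 + (M : ℝ) * (M + 1) * (2 * M + 1) / 6)
    (hD : D = (M : ℝ) * N / 12 * ((N : ℝ) * ((N : ℝ) ^ 2 - 1) + (M : ℝ) * ((M : ℝ) ^ 2 - 1))) :
    ((Gamma M N)ᵀ * Gamma M N)⁻¹ =
      (1 / D) •
        !![(M : ℝ) * K - (M : ℝ) ^ 2 * ((M : ℝ) + 1) ^ 2 / 4,
             (M : ℝ) * N * ((M : ℝ) + 1) * ((N : ℝ) + 1) / 4,
             -((M : ℝ) * N * ((N : ℝ) + 1) / 2);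
           (M : ℝ) * N * ((M : ℝ) + 1) * ((N : ℝ) + 1) / 4,
             (N : ℝ) * K - (N : ℝ) ^ 2 * ((N : ℝ) + 1) ^ 2 / 4,
             -((N : ℝ) * M * ((M : ℝ) + 1) / 2);
           -((M : ℝ) * N * ((N : ℝ) + 1) / 2),
             -((N : ℝ) * M * ((M : ℝ) + 1) / 2),
             (M : ℝ) * N] := by
  have hM' : (0 : ℝ) < M := by exact_mod_cast hM
  have hN' : (0 : ℝ) < N := by exact_mod_cast hN
  have hpos : 0 < D := by
    rw [hD]
    refine mul_pos (by positivity) ?_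
    rcases le_max_iff.mp h2 with h | h
    · linarith [cube_aux2 M h, cube_aux N hN]
    · linarith [cube_aux2 N h, cube_aux M hM]
  apply Matrix.inv_eq_right_inv
  rw [gram_aux, Matrix.mul_smul]
  have key : ∀ A : Matrix (Fin 3) (Fin 3) ℝ, A = D • (1 : Matrix (Fin 3) (Fin 3) ℝ) →
      (1 / D) • A = 1 := by
    intro A hA
    rw [hA, smul_smul, one_div, inv_mul_cancel₀ hpos.ne', one_smul]
  apply key
  rw [hD, hK]
  ext i j
  fin_cases i <;> fin_cases j <;>
    simp [Matrix.mul_apply, Fin.sum_univ_three] <;> ring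
end

section
/- Let α⁰, γ⁰, μ⁰ be real numbers. For every pair of integers M, N ≥ 2, let e₁^{(M,N)},…,e_N^{(M,N)} and f₁^{(M,N)},…,f_M^{(M,N)} be real numbers, and suppose that M · max_{1≤n≤N} |e_n^{(M,N)}| → 0 and N · max_{1≤m≤M} |f_m^{(M,N)}| → 0 as min{M, N} → ∞. Let Λ_{M,N} be the (N+M)-dimensional vector with n-th entry α⁰ + nμ⁰ + e_n^{(M,N)} (n = 1,…,N) and (N+m)-th entry γ⁰ + mμ⁰ + f_m^{(M,N)} (m = 1,…,M), and let (α̂_{M,N}, γ̂_{M,N}, μ̂_{M,N})ᵀ = (Γᵀ Γ)⁻¹ Γᵀ Λ_{M,N}. Then (α̂_{M,N}, γ̂_{M,N}, μ̂_{M,N}) → (α⁰, γ⁰, μ⁰) as min{M, N} → ∞ (i.e., for every ε > 0 there exists M₀ such that the estimate is within ε of (α⁰, γ⁰, μ⁰) whenever M ≥ M₀ and N ≥ M₀). This is the deterministic core of the strong consistency theorem (Theorem 1) for the frequency and interaction parameters. -/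
open Matrix

lemma aux_sum1 (N : ℕ) : ∑ i : Fin N, (((i : ℕ) + 1 : ℕ) : ℝ) = N * (N + 1) / 2 := by
  rw [Fin.sum_univ_eq_sum_range (fun i => ((i + 1 : ℕ) : ℝ))]
  induction N with
  | zero => simp
  | succ k ih => rw [Finset.sum_range_succ, ih]; push_cast; ring

lemma aux_sum2 (N : ℕ) : ∑ i : Fin N, (((i : ℕ) + 1 : ℕ) : ℝ) * (((i : ℕ) + 1 : ℕ) : ℝ)
    = N * (N + 1) * (2 * N + 1) / 6 := by
  rw [Fin.sum_univ_eq_sum_range (fun i => ((i + 1 : ℕ) : ℝ) * ((i + 1 : ℕ) : ℝ))]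
  induction N with
  | zero => simp
  | succ k ih => rw [Finset.sum_range_succ, ih]; push_cast; ring

lemma aux_bd1 (N : ℕ) (E : Fin N → ℝ) (t : ℝ) (h : ∀ i, |E i| ≤ t) :
    |∑ i, E i| ≤ N * t := by
  refine (Finset.abs_sum_le_sum_abs _ _).trans ?_
  refine (Finset.sum_le_sum (fun i _ => h i)).trans ?_
  simp

lemma aux_bd2 (N : ℕ) (E : Fin N → ℝ) (t : ℝ) (h : ∀ i, |E i| ≤ t) :
    |∑ i : Fin N, (((i : ℕ) + 1 : ℕ) : ℝ) * E i - (N + 1) / 2 * ∑ i, E i| ≤ N * (N / 2 * t) := by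
  rw [Finset.mul_sum, ← Finset.sum_sub_distrib]
  apply aux_bd1
  intro i
  rw [← sub_mul, abs_mul]
  have hi : ((i : ℕ) : ℝ) + 1 ≤ N := by exact_mod_cast i.2
  have h0 : (0 : ℝ) ≤ ((i : ℕ) : ℝ) := by positivity
  apply mul_le_mul _ (h i) (abs_nonneg _) (by positivity)
  rw [abs_le]
  push_cast
  constructor <;> linarith

lemma aux_gram (M N : ℕ) : (Gamma M N)ᵀ * Gamma M N =
    !![(N : ℝ), 0, N * (N + 1) / 2; 0, (M : ℝ), M * (M + 1) / 2;
      N * (N + 1) / 2, M * (M + 1) / 2,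
      N * (N + 1) * (2 * N + 1) / 6 + M * (M + 1) * (2 * M + 1) / 6] := by
  have s1 := aux_sum1 N
  have s2 := aux_sum1 M
  have s3 := aux_sum2 N
  have s4 := aux_sum2 M
  push_cast at s1 s2 s3 s4
  ext i j
  rw [Matrix.mul_apply, Fin.sum_univ_add]
  fin_cases i <;> fin_cases j <;> simp [Gamma, s1, s2, s3, s4]

lemma aux_rhs (M N : ℕ) (L : Fin (N + M) → ℝ) (α γ μ : ℝ) (E : Fin N → ℝ) (F : Fin M → ℝ)
    (h1 : ∀ i, L (Fin.castAdd M i) = α + (((i : ℕ) + 1 : ℕ) : ℝ) * μ + E i)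
    (h2 : ∀ i, L (Fin.natAdd N i) = γ + (((i : ℕ) + 1 : ℕ) : ℝ) * μ + F i) :
    ((Gamma M N)ᵀ *ᵥ L) 0 = N * α + N * (N + 1) / 2 * μ + ∑ i, E i ∧
    ((Gamma M N)ᵀ *ᵥ L) 1 = M * γ + M * (M + 1) / 2 * μ + ∑ i, F i ∧
    ((Gamma M N)ᵀ *ᵥ L) 2 = N * (N + 1) / 2 * α + M * (M + 1) / 2 * γ +
      (N * (N + 1) * (2 * N + 1) / 6 + M * (M + 1) * (2 * M + 1) / 6) * μ
      + ∑ i : Fin N, (((i : ℕ) + 1 : ℕ) : ℝ) * E i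
      + ∑ i : Fin M, (((i : ℕ) + 1 : ℕ) : ℝ) * F i := by
  refine ⟨?_, ?_, ?_⟩
  · rw [← aux_sum1, Matrix.mulVec, dotProduct, Fin.sum_univ_add]
    simp [Gamma, h1, h2, Finset.sum_add_distrib, add_mul, Finset.sum_mul]
  · rw [← aux_sum1, Matrix.mulVec, dotProduct, Fin.sum_univ_add]
    simp [Gamma, h1, h2, Finset.sum_add_distrib, add_mul, Finset.sum_mul]
  · rw [← aux_sum1, ← aux_sum1, ← aux_sum2, ← aux_sum2, Matrix.mulVec, dotProduct,
      Fin.sum_univ_add]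
    simp only [Gamma, h1, h2, Matrix.transpose_apply, Fin.val_castAdd, Fin.is_lt, if_true,
      Fin.val_natAdd, add_lt_iff_neg_left, not_lt_zero, if_false, Nat.add_sub_cancel_left,
      show (2 : Fin 3) ≠ 0 by decide, show (2 : Fin 3) ≠ 1 by decide,
      mul_add, add_mul, Finset.sum_add_distrib, Finset.sum_mul, mul_assoc]
    ring

lemma aux_fin (k l c d x R : ℝ) (hd : 0 < d) (hk : 2 ≤ k) (hl : 2 ≤ l)
    (he : k * x + k * (k + 1) / 2 * c = R)
    (hR : |R| ≤ k * (d / l)) (hck : |c| * k ≤ 8 * d) : |x| ≤ 9 * d := by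
  have hx : x = R / k - (k + 1) / 2 * c := by
    rw [← he]; field_simp; ring
  have hRk : |R / k| ≤ d := by
    rw [abs_div, abs_of_pos (show 0 < k by linarith), div_le_iff₀ (by linarith)]
    have h3 : d / l ≤ d := div_le_self hd.le (by linarith)
    have h4 := mul_le_mul_of_nonneg_left h3 (show 0 ≤ k by linarith)
    linarith
  have h2 : |(k + 1) / 2 * c| ≤ 8 * d := by
    rw [abs_mul, abs_of_pos (show 0 < (k + 1) / 2 by linarith)]
    nlinarith [abs_nonneg c]
  rw [hx]
  exact (abs_sub _ _).trans (by linarith)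

lemma aux_real (m n a b c P Q P' Q' d : ℝ) (hm : 2 ≤ m) (hn : 2 ≤ n) (hd : 0 < d)
    (e1 : n * a + n * (n + 1) / 2 * c = P)
    (e2 : m * b + m * (m + 1) / 2 * c = Q)
    (e3 : n * (n + 1) / 2 * a + m * (m + 1) / 2 * b +
      (n * (n + 1) * (2 * n + 1) / 6 + m * (m + 1) * (2 * m + 1) / 6) * c = P' + Q')
    (hP : |P| ≤ n * (d / m)) (hQ : |Q| ≤ m * (d / n))
    (hP' : |P' - (n + 1) / 2 * P| ≤ n * (n / 2 * (d / m)))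
    (hQ' : |Q' - (m + 1) / 2 * Q| ≤ m * (m / 2 * (d / n))) :
    |a| ≤ 9 * d ∧ |b| ≤ 9 * d ∧ |c| ≤ 9 * d := by
  have key : c * ((n * (n ^ 2 - 1) + m * (m ^ 2 - 1)) / 12) =
      (P' - (n + 1) / 2 * P) + (Q' - (m + 1) / 2 * Q) := by
    rw [← e1, ← e2]; linear_combination e3
  have hn4 : 4 ≤ n ^ 2 := by nlinarith
  have hm4 : 4 ≤ m ^ 2 := by nlinarith
  have hD : (n ^ 3 + m ^ 3) / 16 ≤ (n * (n ^ 2 - 1) + m * (m ^ 2 - 1)) / 12 := by nlinarith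
  have hpos : 0 < n ^ 3 + m ^ 3 := by positivity
  have hc : |c| * ((n ^ 3 + m ^ 3) / 16) ≤ (n ^ 2 / m + m ^ 2 / n) * (d / 2) := by
    calc |c| * ((n ^ 3 + m ^ 3) / 16)
        ≤ |c| * ((n * (n ^ 2 - 1) + m * (m ^ 2 - 1)) / 12) :=
          mul_le_mul_of_nonneg_left hD (abs_nonneg c)
      _ = |c * ((n * (n ^ 2 - 1) + m * (m ^ 2 - 1)) / 12)| := by
          rw [abs_mul, abs_of_nonneg (a := (n * (n ^ 2 - 1) + m * (m ^ 2 - 1)) / 12)]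
          linarith
      _ ≤ n * (n / 2 * (d / m)) + m * (m / 2 * (d / n)) := by
          rw [key]; exact (abs_add_le _ _).trans (add_le_add hP' hQ')
      _ = _ := by ring
  have i1 : n * (n ^ 2 / m + m ^ 2 / n) ≤ n ^ 3 + m ^ 3 := by
    have : n * (n ^ 2 / m + m ^ 2 / n) = n ^ 3 / m + m ^ 2 := by field_simp
    rw [this]
    have : n ^ 3 / m ≤ n ^ 3 := div_le_self (by positivity) (by linarith)
    nlinarith
  have i2 : m * (n ^ 2 / m + m ^ 2 / n) ≤ n ^ 3 + m ^ 3 := by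
    have : m * (n ^ 2 / m + m ^ 2 / n) = n ^ 2 + m ^ 3 / n := by field_simp
    rw [this]
    have : m ^ 3 / n ≤ m ^ 3 := div_le_self (by positivity) (by linarith)
    nlinarith
  have hcn : |c| * n ≤ 8 * d := by
    have h1 := mul_le_mul_of_nonneg_left hc (show 0 ≤ n by linarith)
    have h2 := mul_le_mul_of_nonneg_right i1 (show 0 ≤ d / 2 by linarith)
    have : (|c| * n) * (n ^ 3 + m ^ 3) ≤ 8 * d * (n ^ 3 + m ^ 3) := by linarith
    exact le_of_mul_le_mul_right this hpos
  have hcm : |c| * m ≤ 8 * d := by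
    have h1 := mul_le_mul_of_nonneg_left hc (show 0 ≤ m by linarith)
    have h2 := mul_le_mul_of_nonneg_right i2 (show 0 ≤ d / 2 by linarith)
    have : (|c| * m) * (n ^ 3 + m ^ 3) ≤ 8 * d * (n ^ 3 + m ^ 3) := by linarith
    exact le_of_mul_le_mul_right this hpos
  refine ⟨aux_fin n m c d a P hd hn hm e1 hP hcn, aux_fin m n c d b Q hd hm hn e2 hQ hcm, ?_⟩
  nlinarith [abs_nonneg c]

/-- deterministic core of Theorem 1 (strong consistency of the estimators of
`α⁰`, `γ⁰`, `μ⁰`). If the column-wise errors satisfy `M·maxₙ|eₙ| → 0` and the row-wise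
errors satisfy `N·maxₘ|fₘ| → 0` as `min{M,N} → ∞`, then the Step-1 estimates
`(α̂, γ̂, μ̂)ᵀ = (Γᵀ Γ)⁻¹ Γᵀ Λ` converge to `(α⁰, γ⁰, μ⁰)` as `min{M,N} → ∞`. -/
theorem gamma_step1_consistency (α γ μ : ℝ) (e f : ℕ → ℕ → ℕ → ℝ)
    (he : ∀ ε : ℝ, 0 < ε → ∃ K : ℕ, ∀ M N : ℕ, K ≤ M → K ≤ N →
      ∀ n ∈ Finset.Icc 1 N, (M : ℝ) * |e M N n| < ε)
    (hf : ∀ ε : ℝ, 0 < ε → ∃ K : ℕ, ∀ M N : ℕ, K ≤ M → K ≤ N →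
      ∀ m ∈ Finset.Icc 1 M, (N : ℝ) * |f M N m| < ε)
    (Λ : ∀ M N : ℕ, Fin (N + M) → ℝ)
    (hΛ : ∀ M N : ℕ, ∀ i : Fin (N + M), Λ M N i =
      if (i : ℕ) < N then α + ((((i : ℕ) + 1 : ℕ) : ℝ)) * μ + e M N ((i : ℕ) + 1)
      else γ + ((((i : ℕ) - N + 1 : ℕ) : ℝ)) * μ + f M N ((i : ℕ) - N + 1))
    (est : ∀ M N : ℕ, Fin 3 → ℝ)
    (hest : ∀ M N : ℕ,
      est M N = ((Gamma M N)ᵀ * Gamma M N)⁻¹ *ᵥ ((Gamma M N)ᵀ *ᵥ Λ M N)) :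
    ∀ ε : ℝ, 0 < ε → ∃ M₀ : ℕ, 2 ≤ M₀ ∧ ∀ M N : ℕ, M₀ ≤ M → M₀ ≤ N →
      |est M N 0 - α| < ε ∧ |est M N 1 - γ| < ε ∧ |est M N 2 - μ| < ε := by
  intro ε hε
  obtain ⟨K1, hK1⟩ := he (ε / 10) (by positivity)
  obtain ⟨K2, hK2⟩ := hf (ε / 10) (by positivity)
  refine ⟨K1 + K2 + 2, by omega, fun M N hM hN => ?_⟩
  have hm : (2 : ℝ) ≤ M := by exact_mod_cast (by omega : 2 ≤ M)
  have hn : (2 : ℝ) ≤ N := by exact_mod_cast (by omega : 2 ≤ N)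
  have hE : ∀ i : Fin N, |e M N ((i : ℕ) + 1)| ≤ ε / 10 / M := by
    intro i
    rw [le_div_iff₀ (by linarith), mul_comm]
    exact (hK1 M N (by omega) (by omega) _ (by simp)).le
  have hF : ∀ i : Fin M, |f M N ((i : ℕ) + 1)| ≤ ε / 10 / N := by
    intro i
    rw [le_div_iff₀ (by linarith), mul_comm]
    exact (hK2 M N (by omega) (by omega) _ (by simp)).le
  obtain ⟨r1, r2, r3⟩ := aux_rhs M N (Λ M N) α γ μ (fun i => e M N ((i : ℕ) + 1))
    (fun i => f M N ((i : ℕ) + 1)) (fun i => by rw [hΛ]; simp) (fun i => by rw [hΛ]; simp)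
  have hdet : IsUnit ((Gamma M N)ᵀ * Gamma M N).det := by
    rw [aux_gram, isUnit_iff_ne_zero, Matrix.det_fin_three]
    simp
    have h4 : (0 : ℝ) < M * N * ((N * (N ^ 2 - 1) + M * (M ^ 2 - 1)) / 12) := by
      have : (0 : ℝ) < (N : ℝ) ^ 2 - 1 := by nlinarith
      have : (0 : ℝ) < (M : ℝ) ^ 2 - 1 := by nlinarith
      positivity
    intro h
    apply h4.ne'
    rw [← h]
    ring
  have hA : ((Gamma M N)ᵀ * Gamma M N) *ᵥ est M N = (Gamma M N)ᵀ *ᵥ Λ M N := by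
    rw [hest, Matrix.mulVec_mulVec, Matrix.mul_nonsing_inv _ hdet, Matrix.one_mulVec]
  rw [← hA, aux_gram] at r1 r2 r3
  simp only [Matrix.mulVec, dotProduct, Fin.sum_univ_three] at r1 r2 r3
  simp at r1 r2 r3
  have b1 := aux_bd2 N _ _ hE
  have b2 := aux_bd2 M _ _ hF
  push_cast at b1 b2
  obtain ⟨h1, h2, h3⟩ := aux_real M N (est M N 0 - α) (est M N 1 - γ) (est M N 2 - μ)
    _ _ _ _ (ε / 10) hm hn (by positivity) (by linear_combination r1) (by linear_combination r2)
    (by linear_combination r3) (aux_bd1 N _ _ hE) (aux_bd1 M _ _ hF) b1 b2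
  refine ⟨?_, ?_, ?_⟩ <;> linarith
end
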